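/- arXiv:2309.14472 — 5 statements merged into one kernel-verified Lean document; each statement's English description precedes it below -/
import Mathlib

section
/- Let κ > 0 and t₀ > 0. Suppose R : (0, t₀] → ℝ is continuously differentiable with R(t) > 0 and Ṙ(t) > 0, and ρ, p : (0, t₀] → ℝ satisfy the flat Friedmann equations H² = (κ/3)ρ and ρ̇ = −3(p + ρ)H, where H = Ṙ/R. Assume 0 ≤ p(t) ≤ ρ(t)/3 for all t, lim_{t→0⁺} R(t) = 0, R(t₀) = 1, and set H₀ = H(t₀) > 0. Then the age of the universe satisfies 1/(2H₀) ≤ t₀ ≤ 2/(3H₀). -/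
open Set Filter

/-- A function with nonnegative derivative on `(0, T]` is bounded there by its value at `T`. -/
theorem le_right_of_hasDerivAt_nonneg {T : ℝ} {f f' : ℝ → ℝ}
    (hf : ∀ t ∈ Ioc (0 : ℝ) T, HasDerivAt f (f' t) t)
    (hf' : ∀ t ∈ Ioc (0 : ℝ) T, 0 ≤ f' t) {t : ℝ} (ht : t ∈ Ioc (0 : ℝ) T) : f t ≤ f T := by
  have hmono : MonotoneOn f (Ioc 0 T) :=
    monotoneOn_of_hasDerivWithinAt_nonneg (convex_Ioc 0 T)
      (fun x hx => (hf x hx).continuousAt.continuousWithinAt)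
      (fun x hx => (hf x (interior_subset hx)).hasDerivWithinAt)
      (fun x hx => hf' x (interior_subset hx))
  exact hmono ht ⟨ht.1.trans_le ht.2, le_rfl⟩ ht.2

/-- A function with nonnegative derivative on `(0, T]` has its right limit at `0` bounded by its
value at `T`. -/
theorem lim_le_right_of_hasDerivAt_nonneg {T L : ℝ} (hT : 0 < T) {f f' : ℝ → ℝ}
    (hf : ∀ t ∈ Ioc (0 : ℝ) T, HasDerivAt f (f' t) t)
    (hf' : ∀ t ∈ Ioc (0 : ℝ) T, 0 ≤ f' t)
    (hL : Tendsto f (nhdsWithin 0 (Ioi 0)) (nhds L)) : L ≤ f T := by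
  refine le_of_tendsto hL ?_
  filter_upwards [Ioc_mem_nhdsGT hT] with t ht
  exact le_right_of_hasDerivAt_nonneg hf hf' ht

/-- For a flat FRW solution with `0 ≤ p ≤ ρ/3`, the age of the universe
satisfies `1/(2H₀) ≤ t₀ ≤ 2/(3H₀)`. -/
theorem frw_age_bounds
    (κ t₀ : ℝ) (hκ : 0 < κ) (ht₀ : 0 < t₀)
    (R R' ρ ρ' p : ℝ → ℝ)
    (hRderiv : ∀ t ∈ Ioc (0:ℝ) t₀, HasDerivAt R (R' t) t)
    (hR'cont : ContinuousOn R' (Ioc 0 t₀))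
    (hRpos : ∀ t ∈ Ioc (0:ℝ) t₀, 0 < R t)
    (hR'pos : ∀ t ∈ Ioc (0:ℝ) t₀, 0 < R' t)
    (hρderiv : ∀ t ∈ Ioc (0:ℝ) t₀, HasDerivAt ρ (ρ' t) t)
    (hFried1 : ∀ t ∈ Ioc (0:ℝ) t₀, (R' t / R t) ^ 2 = (κ / 3) * ρ t)
    (hFried2 : ∀ t ∈ Ioc (0:ℝ) t₀, ρ' t = -3 * (p t + ρ t) * (R' t / R t))
    (hp : ∀ t ∈ Ioc (0:ℝ) t₀, 0 ≤ p t ∧ p t ≤ ρ t / 3)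
    (hR0 : Tendsto R (nhdsWithin 0 (Ioi 0)) (nhds 0))
    (hRt₀ : R t₀ = 1)
    (H₀ : ℝ) (hH₀ : H₀ = R' t₀ / R t₀) (hH₀pos : 0 < H₀) :
    1 / (2 * H₀) ≤ t₀ ∧ t₀ ≤ 2 / (3 * H₀) := by
  have hmem : t₀ ∈ Ioc (0 : ℝ) t₀ := ⟨ht₀, le_rfl⟩
  have hid : Tendsto (fun t : ℝ => t) (nhdsWithin 0 (Ioi 0)) (nhds 0) :=
    tendsto_id.mono_left nhdsWithin_le_nhds
  have hρ₀ : κ / 3 * ρ t₀ = H₀ ^ 2 := by rw [← hFried1 t₀ hmem, ← hH₀]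
  have hR'sq : ∀ t ∈ Ioc (0 : ℝ) t₀, R' t ^ 2 = κ / 3 * ρ t * R t ^ 2 := by
    intro t ht
    have := (hRpos t ht).ne'
    rw [← hFried1 t ht]
    field_simp
  constructor
  · have hquart : ∀ t ∈ Ioc (0 : ℝ) t₀, ρ t * R t ^ 4 ≤ ρ t₀ := by
      intro t ht
      have := le_right_of_hasDerivAt_nonneg (f := fun t => ρ t * R t ^ 4)
        (f' := fun t => R t ^ 3 * R' t * (ρ t - 3 * p t)) ?_ ?_ ht
      · simpa [hRt₀] using this
      · intro s hs
        have hne := (hRpos s hs).ne'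
        refine HasDerivAt.congr_deriv ((hρderiv s hs).mul ((hRderiv s hs).pow 4)) ?_
        simp only [hFried2 s hs]
        push_cast
        field_simp
        ring
      · intro s hs
        have h1 := hRpos s hs
        have h2 := hR'pos s hs
        have h3 : 0 ≤ ρ s - 3 * p s := by linarith [(hp s hs).2]
        positivity
    have hlim : Tendsto (fun t => 2 * H₀ * t - R t ^ 2) (nhdsWithin 0 (Ioi 0)) (nhds 0) := by
      simpa using (hid.const_mul (2 * H₀)).sub (hR0.pow 2)
    have hage := lim_le_right_of_hasDerivAt_nonneg ht₀
      (f' := fun t => 2 * H₀ - 2 * (R t * R' t)) ?_ ?_ hlim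
    · rw [hRt₀] at hage
      rw [div_le_iff₀ (by positivity)]
      linarith
    · intro t ht
      refine HasDerivAt.congr_deriv (((hasDerivAt_id t).const_mul (2 * H₀)).sub
        ((hRderiv t ht).pow 2)) ?_
      simp
      ring
    · intro t ht
      have hsq : (R t * R' t) ^ 2 ≤ H₀ ^ 2 := by
        rw [mul_pow, hR'sq t ht, ← hρ₀]
        calc R t ^ 2 * (κ / 3 * ρ t * R t ^ 2) = κ / 3 * (ρ t * R t ^ 4) := by ring
          _ ≤ κ / 3 * ρ t₀ := by gcongr; exact hquart t ht
      have := le_of_pow_le_pow_left₀ two_ne_zero hH₀pos.le hsq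
      linarith
  · have hcube : ∀ t ∈ Ioc (0 : ℝ) t₀, ρ t₀ ≤ ρ t * R t ^ 3 := by
      intro t ht
      have := le_right_of_hasDerivAt_nonneg (f := fun t => -(ρ t * R t ^ 3))
        (f' := fun t => 3 * (R t ^ 2 * R' t * p t)) ?_ ?_ ht
      · simpa [hRt₀] using this
      · intro s hs
        have hne := (hRpos s hs).ne'
        refine HasDerivAt.congr_deriv (((hρderiv s hs).mul ((hRderiv s hs).pow 3)).neg) ?_
        simp only [hFried2 s hs, Pi.pow_apply]
        push_cast
        field_simp
        ring
      · intro s hs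
        have h1 := hRpos s hs
        have h2 := hR'pos s hs
        have h3 := (hp s hs).1
        positivity
    have hlim : Tendsto (fun t => √(R t ^ 3) - 3 / 2 * H₀ * t) (nhdsWithin 0 (Ioi 0))
        (nhds 0) := by
      simpa using (hR0.pow 3).sqrt.sub (hid.const_mul (3 / 2 * H₀))
    have hage := lim_le_right_of_hasDerivAt_nonneg ht₀
      (f' := fun t => 3 * R t ^ 2 * R' t / (2 * √(R t ^ 3)) - 3 / 2 * H₀) ?_ ?_ hlim
    · rw [hRt₀, one_pow, Real.sqrt_one] at hage
      rw [le_div_iff₀ (by positivity)]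
      linarith
    · intro t ht
      have hne : R t ^ 3 ≠ 0 := pow_ne_zero 3 (hRpos t ht).ne'
      refine HasDerivAt.congr_deriv ((((hRderiv t ht).pow 3).sqrt hne).sub
        ((hasDerivAt_id t).const_mul (3 / 2 * H₀))) ?_
      simp
    · intro t ht
      have h1 := hRpos t ht
      have h2 := hR'pos t ht
      have hsq : (H₀ * √(R t ^ 3)) ^ 2 ≤ (R t ^ 2 * R' t) ^ 2 := by
        rw [mul_pow, mul_pow, Real.sq_sqrt (by positivity), hR'sq t ht, ← hρ₀]
        calc κ / 3 * ρ t₀ * R t ^ 3 ≤ κ / 3 * (ρ t * R t ^ 3) * R t ^ 3 := by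
              gcongr; exact hcube t ht
          _ = (R t ^ 2) ^ 2 * (κ / 3 * ρ t * R t ^ 2) := by ring
      have hle := le_of_pow_le_pow_left₀ two_ne_zero (by positivity) hsq
      rw [sub_nonneg, le_div_iff₀ (by positivity)]
      linarith
end

section
/- Let κ > 0 and t₀ > 0. Suppose R : (0, t₀] → ℝ is continuously differentiable with R(t) > 0 and Ṙ(t) > 0, and ρ, p : (0, t₀] → ℝ satisfy the flat Friedmann equations H² = (κ/3)ρ and ρ̇ = −3(p + ρ)H, where H = Ṙ/R. Assume 0 ≤ p(t) ≤ ρ(t)/3 for all t, lim_{t→0⁺} R(t) = 0, R(t₀) = 1, and set H₀ = H(t₀) > 0. Then the improper integral r_∞ = ∫₀^{t₀} dτ/R(τ) converges and satisfies 1/H₀ ≤ r_∞ ≤ 2/H₀. -/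
open Set Filter MeasureTheory

/-- A function with nonnegative derivative on `(0, b]` is bounded there by its value at `b`. -/
theorem le_right_endpoint_of_hasDerivAt_nonneg {f f' : ℝ → ℝ} {b : ℝ}
    (hf : ∀ t ∈ Ioc (0:ℝ) b, HasDerivAt f (f' t) t)
    (hf' : ∀ t ∈ Ioc (0:ℝ) b, 0 ≤ f' t) {t : ℝ} (ht : t ∈ Ioc (0:ℝ) b) : f t ≤ f b := by
  have hmono : MonotoneOn f (Ioc 0 b) :=
    monotoneOn_of_hasDerivWithinAt_nonneg (convex_Ioc 0 b)
      (fun x hx => (hf x hx).continuousAt.continuousWithinAt)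
      (fun x hx => (hf x (interior_subset hx)).hasDerivWithinAt)
      (fun x hx => hf' x (interior_subset hx))
  exact hmono ht ⟨ht.1.trans_le ht.2, le_rfl⟩ ht.2

/-- For a flat FRW solution with `0 ≤ p ≤ ρ/3`, the infinite redshift limit
`r_∞ = ∫₀^{t₀} dτ/R(τ)` converges and satisfies `1/H₀ ≤ r_∞ ≤ 2/H₀`. -/
theorem frw_infinite_redshift_bounds
    (κ t₀ : ℝ) (hκ : 0 < κ) (ht₀ : 0 < t₀)
    (R R' ρ ρ' p : ℝ → ℝ)
    (hRderiv : ∀ t ∈ Ioc (0:ℝ) t₀, HasDerivAt R (R' t) t)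
    (hR'cont : ContinuousOn R' (Ioc 0 t₀))
    (hRpos : ∀ t ∈ Ioc (0:ℝ) t₀, 0 < R t)
    (hR'pos : ∀ t ∈ Ioc (0:ℝ) t₀, 0 < R' t)
    (hρderiv : ∀ t ∈ Ioc (0:ℝ) t₀, HasDerivAt ρ (ρ' t) t)
    (hFried1 : ∀ t ∈ Ioc (0:ℝ) t₀, (R' t / R t) ^ 2 = (κ / 3) * ρ t)
    (hFried2 : ∀ t ∈ Ioc (0:ℝ) t₀, ρ' t = -3 * (p t + ρ t) * (R' t / R t))
    (hp : ∀ t ∈ Ioc (0:ℝ) t₀, 0 ≤ p t ∧ p t ≤ ρ t / 3)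
    (hR0 : Tendsto R (nhdsWithin 0 (Ioi 0)) (nhds 0))
    (hRt₀ : R t₀ = 1)
    (H₀ : ℝ) (hH₀ : H₀ = R' t₀ / R t₀) (hH₀pos : 0 < H₀) :
    IntegrableOn (fun τ => 1 / R τ) (Ioc 0 t₀) volume ∧
    1 / H₀ ≤ ∫ τ in Ioc (0:ℝ) t₀, 1 / R τ ∧
    (∫ τ in Ioc (0:ℝ) t₀, 1 / R τ) ≤ 2 / H₀ := by
  have hmem₀ : t₀ ∈ Ioc (0:ℝ) t₀ := ⟨ht₀, le_rfl⟩
  have hsq (t) (ht : t ∈ Ioc (0:ℝ) t₀) : R' t ^ 2 = κ / 3 * ρ t * R t ^ 2 := by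
    rw [← hFried1 t ht, div_pow, div_mul_cancel₀ _ (pow_pos (hRpos t ht) 2).ne']
  have hρ₀ : κ / 3 * ρ t₀ = H₀ ^ 2 := by rw [← hFried1 t₀ hmem₀, hH₀]
  have hradiation (t) (ht : t ∈ Ioc (0:ℝ) t₀) : ρ t * R t ^ 4 ≤ ρ t₀ := by
    have h := le_right_endpoint_of_hasDerivAt_nonneg
      (f := fun t => ρ t * R t ^ 4) (f' := fun t => R t ^ 3 * R' t * (ρ t - 3 * p t))
      (fun s hs => by
        have hR := (hRpos s hs).ne'
        refine ((hρderiv s hs).mul ((hRderiv s hs).pow 4)).congr_deriv ?_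
        rw [hFried2 s hs]
        simp only [Pi.pow_apply]
        field_simp
        push_cast
        ring)
      (fun s hs => mul_nonneg (mul_pos (pow_pos (hRpos s hs) 3) (hR'pos s hs)).le
        (by linarith [(hp s hs).2])) ht
    simpa [hRt₀] using h
  have hdust (t) (ht : t ∈ Ioc (0:ℝ) t₀) : ρ t₀ ≤ ρ t * R t ^ 3 := by
    have h := le_right_endpoint_of_hasDerivAt_nonneg
      (f := fun t => -(ρ t * R t ^ 3)) (f' := fun t => 3 * p t * (R t ^ 2 * R' t))
      (fun s hs => by
        have hR := (hRpos s hs).ne'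
        refine ((hρderiv s hs).mul ((hRderiv s hs).pow 3)).neg.congr_deriv ?_
        rw [hFried2 s hs]
        simp only [Pi.pow_apply]
        field_simp
        push_cast
        ring)
      (fun s hs => mul_nonneg (mul_nonneg (by norm_num) (hp s hs).1)
        (mul_pos (pow_pos (hRpos s hs) 2) (hR'pos s hs)).le) ht
    simpa [hRt₀] using h
  have hlower (t) (ht : t ∈ Ioc (0:ℝ) t₀) : R' t / H₀ ≤ 1 / R t := by
    rw [div_le_div_iff₀ hH₀pos (hRpos t ht), one_mul]
    refine le_of_sq_le_sq ?_ hH₀pos.le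
    calc (R' t * R t) ^ 2 = κ / 3 * (ρ t * R t ^ 4) := by rw [mul_pow, hsq t ht]; ring
      _ ≤ κ / 3 * ρ t₀ := by gcongr; exact hradiation t ht
      _ = H₀ ^ 2 := hρ₀
  have hupper (t) (ht : t ∈ Ioc (0:ℝ) t₀) :
      1 / R t ≤ 2 / H₀ * (R' t / (2 * √(R t))) := by
    have hs : 0 < √(R t) := Real.sqrt_pos.2 (hRpos t ht)
    have hss : √(R t) ^ 2 = R t := Real.sq_sqrt (hRpos t ht).le
    have hkey : H₀ ≤ R' t * √(R t) := by
      refine le_of_sq_le_sq ?_ (mul_pos (hR'pos t ht) hs).le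
      calc H₀ ^ 2 = κ / 3 * ρ t₀ := hρ₀.symm
        _ ≤ κ / 3 * (ρ t * R t ^ 3) := by gcongr; exact hdust t ht
        _ = (R' t * √(R t)) ^ 2 := by rw [mul_pow, hsq t ht, hss]; ring
    calc 1 / R t = H₀ / (H₀ * R t) := by field_simp
      _ ≤ R' t * √(R t) / (H₀ * R t) := by
        have := hRpos t ht
        gcongr
      _ = 2 / H₀ * (R' t / (2 * √(R t))) := by
        nth_rewrite 2 [← hss]
        field_simp
  -- `R` extended continuously by `0` to the big bang time
  set S : ℝ → ℝ := Function.update R 0 0 with hS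
  have hS0 : S 0 = 0 := by simp [hS]
  have hSR (t) (ht : t ≠ 0) : S t = R t := by simp [hS, ht]
  have hSt₀ : S t₀ = 1 := by rw [hSR t₀ ht₀.ne', hRt₀]
  have hSderiv (t) (ht : t ∈ Ioc (0:ℝ) t₀) : HasDerivAt S (R' t) t :=
    (hRderiv t ht).congr_of_eventuallyEq
      ((eventually_ne_nhds ht.1.ne').mono fun s hs => hSR s hs)
  have hScont : ContinuousOn S (Icc 0 t₀) := by
    intro t ht
    rcases ht.1.eq_or_lt with rfl | h
    · rw [hS, continuousWithinAt_update_same]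
      exact hR0.mono_left (nhdsWithin_mono _ fun x hx => lt_of_le_of_ne hx.1.1 (Ne.symm hx.2))
    · exact (hSderiv t ⟨h, ht.2⟩).continuousAt.continuousWithinAt
  set G : ℝ → ℝ := fun t => 2 / H₀ * √(S t) with hG
  have hGcont : ContinuousOn G (Icc 0 t₀) := continuousOn_const.mul hScont.sqrt
  have hGderiv (t) (ht : t ∈ Ioo (0:ℝ) t₀) :
      HasDerivAt G (2 / H₀ * (R' t / (2 * √(R t)))) t := by
    have ht' := Ioo_subset_Ioc_self ht
    have h := ((hSderiv t ht').sqrt (by rw [hSR t ht.1.ne']; exact (hRpos t ht').ne')).const_mul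
      (2 / H₀)
    rwa [hSR t ht.1.ne'] at h
  have hGint : IntegrableOn (fun t => 2 / H₀ * (R' t / (2 * √(R t)))) (Ioc 0 t₀) :=
    intervalIntegral.integrableOn_deriv_of_nonneg hGcont hGderiv fun t ht => by
      have := hR'pos t (Ioo_subset_Ioc_self ht)
      positivity
  have hRcont : ContinuousOn R (Ioc 0 t₀) :=
    fun t ht => (hRderiv t ht).continuousAt.continuousWithinAt
  have hint : IntegrableOn (fun τ => 1 / R τ) (Ioc 0 t₀) := by
    refine hGint.mono' ((continuousOn_const.div hRcont fun t ht =>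
      (hRpos t ht).ne').aestronglyMeasurable measurableSet_Ioc) ?_
    refine (ae_restrict_iff' measurableSet_Ioc).2 (ae_of_all _ fun t ht => ?_)
    rw [Real.norm_of_nonneg (one_div_pos.2 (hRpos t ht)).le]
    exact hupper t ht
  have hint' : IntegrableOn (fun τ => 1 / R τ) (Icc 0 t₀) :=
    by
    rwa [integrableOn_Icc_iff_integrableOn_Ioc]
  refine ⟨hint, ?_, ?_⟩ <;> rw [← intervalIntegral.integral_of_le ht₀.le]
  · have h := intervalIntegral.sub_le_integral_of_hasDeriv_right_of_le ht₀.le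
      (hScont.div_const H₀)
      (fun t ht => ((hSderiv t (Ioo_subset_Ioc_self ht)).div_const H₀).hasDerivWithinAt) hint'
      (fun t ht => hlower t (Ioo_subset_Ioc_self ht))
    simpa [hS0, hSt₀] using h
  · have h := intervalIntegral.integral_le_sub_of_hasDeriv_right_of_le ht₀.le hGcont
      (fun t ht => (hGderiv t ht).hasDerivWithinAt) hint'
      (fun t ht => hupper t (Ioo_subset_Ioc_self ht))
    simpa [hG, hS0, hSt₀] using h
end

section
/- Let 0 < σ ≤ 1 and define σ̄ = H(σ) := (1/2)√(9σ² + 54σ + 49) − (3/2)σ − 7/2. Let ρ̄ > 0 be arbitrary, and set ρ = 3ρ̄, p = σρ, p̄ = σ̄ρ̄, and A = (1+σ̄)²/(1 + 6σ̄ + σ̄²). Then the conservation constraint across the shock holds: (1 − A)(ρ + p̄)(p + ρ̄)² + (1 − 1/A)(ρ̄ + p̄)(ρ + p)² + (p − p̄)(ρ − ρ̄)² = 0. -/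
open Real

/-- With `σ̄ = H(σ) = (1/2)√(9σ²+54σ+49) − (3/2)σ − 7/2`, `ρ = 3ρ̄`,
`p = σρ`, `p̄ = σ̄ρ̄` and `A = (1+σ̄)²/(1+6σ̄+σ̄²)`, the conservation constraint
`(1−A)(ρ+p̄)(p+ρ̄)² + (1−1/A)(ρ̄+p̄)(ρ+p)² + (p−p̄)(ρ−ρ̄)² = 0` holds across the shock. -/
theorem shock_conservation_constraint
    (σ : ℝ) (hσ0 : 0 < σ) (hσ1 : σ ≤ 1)
    (σb : ℝ) (hσb : σb = (1 / 2) * Real.sqrt (9 * σ ^ 2 + 54 * σ + 49) - (3 / 2) * σ - 7 / 2)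
    (ρb : ℝ) (hρb : 0 < ρb)
    (ρ p pb A : ℝ)
    (hρ : ρ = 3 * ρb) (hp : p = σ * ρ) (hpb : pb = σb * ρb)
    (hA : A = (1 + σb) ^ 2 / (1 + 6 * σb + σb ^ 2)) :
    (1 - A) * (ρ + pb) * (p + ρb) ^ 2 + (1 - 1 / A) * (ρb + pb) * (ρ + p) ^ 2
      + (p - pb) * (ρ - ρb) ^ 2 = 0 := by
  have hsq := Real.sq_sqrt (show (0 : ℝ) ≤ 9 * σ ^ 2 + 54 * σ + 49 by positivity)
  have hroot : Real.sqrt (9 * σ ^ 2 + 54 * σ + 49) = 2 * σb + 3 * σ + 7 := by linarith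
  have hpos : 0 < σb := by
    have : 3 * σ + 7 < Real.sqrt (9 * σ ^ 2 + 54 * σ + 49) :=
      Real.lt_sqrt_of_sq_lt (by nlinarith)
    linarith
  rw [hroot] at hsq
  have hne : 1 - σb ≠ 0 := by
    intro h
    have : σb = 1 := by linarith
    subst this
    nlinarith
  have hσ : σ = (σb ^ 2 + 7 * σb) / (3 * (1 - σb)) := by
    rw [eq_div_iff (by positivity)]
    linarith
  have h₁ : 1 + σb ≠ 0 := by positivity
  have h₂ : 1 + 6 * σb + σb ^ 2 ≠ 0 := by positivity
  clear hσb hroot hsq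
  subst hA hpb hp hρ hσ
  field_simp
  ring
end

section
/- Let H(σ) = (1/2)√(9σ² + 54σ + 49) − (3/2)σ − 7/2. Then H(0) = 0, H is strictly increasing on [0, 1], and 0 < H(σ) < σ for every σ ∈ (0, 1]. -/
open Set

/-- The map `H(σ) = (1/2)√(9σ²+54σ+49) − (3/2)σ − 7/2` satisfies `H(0) = 0`,
is strictly increasing on `[0,1]`, and `0 < H(σ) < σ` for all `σ ∈ (0,1]` (the entropy
condition that the shock be compressive). -/
theorem shock_sound_speed_monotone
    (H : ℝ → ℝ)
    (hH : ∀ σ, H σ = (1 / 2) * Real.sqrt (9 * σ ^ 2 + 54 * σ + 49) - (3 / 2) * σ - 7 / 2) :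
    H 0 = 0 ∧
    StrictMonoOn H (Icc 0 1) ∧
    ∀ σ : ℝ, 0 < σ → σ ≤ 1 → 0 < H σ ∧ H σ < σ := by
  have h0 : H 0 = 0 := by
    have h : Real.sqrt 49 = 7 := by
      rw [show (49 : ℝ) = 7 ^ 2 by norm_num]
      exact Real.sqrt_sq (by norm_num)
    rw [hH]
    norm_num [h]
  have hmono : StrictMonoOn H (Icc 0 1) := by
    intro a ha b _ hab
    have ha0 : 0 ≤ a := ha.1
    have hs : Real.sqrt (9 * a ^ 2 + 54 * a + 49) < 3 * a + 9 := by
      rw [Real.sqrt_lt' (by linarith)]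
      nlinarith
    have hsq := Real.sq_sqrt (show 0 ≤ 9 * a ^ 2 + 54 * a + 49 by positivity)
    have hlt : Real.sqrt (9 * a ^ 2 + 54 * a + 49) + 3 * (b - a) <
        Real.sqrt (9 * b ^ 2 + 54 * b + 49) := by
      apply Real.lt_sqrt_of_sq_lt
      nlinarith [mul_pos (sub_pos.2 hab) (sub_pos.2 hs)]
    rw [hH, hH]
    linarith
  refine ⟨h0, hmono, fun σ hσ hσ1 => ⟨?_, ?_⟩⟩
  · rw [← h0]
    exact hmono ⟨le_rfl, zero_le_one⟩ ⟨hσ.le, hσ1⟩ hσ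
  · have hs : Real.sqrt (9 * σ ^ 2 + 54 * σ + 49) < 5 * σ + 7 := by
      rw [Real.sqrt_lt' (by linarith)]
      nlinarith
    rw [hH]
    linarith
end

section
/- Let 0 < σ ≤ 1, N > 1, and 0 < u < σ, and define w = ((σ−u)N − σ(1+u))/((σ−u)N + (1+u)). If the single condition 1/N < ((1−u)/(1+u)) · ((σ−u)/(σ+u)) holds, then u < w < 1. Consequently, for FRW density ρ > 0, FRW pressure p = σρ, TOV pressure p̄ = uρ, and TOV density ρ̄ = wρ, the entropy inequalities 0 < p̄ < p and 0 < ρ̄ < ρ and the equation of state constraint 0 < p̄ < ρ̄ all hold. Moreover, under these hypotheses, the inequality u < w holds if and only if 1/N < ((1−u)/(1+u))((σ−u)/(σ+u)). -/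
/-- For `0 < σ ≤ 1`, `N > 1`, `0 < u < σ` and
`w = ((σ−u)N − σ(1+u))/((σ−u)N + (1+u))`, the single condition
`1/N < ((1−u)/(1+u))((σ−u)/(σ+u))` implies `u < w < 1`, hence with `p = σρ`, `p̄ = uρ`,
`ρ̄ = wρ` the entropy inequalities `0 < p̄ < p`, `0 < ρ̄ < ρ` and the equation of state
constraint `0 < p̄ < ρ̄` all hold; moreover `u < w` iff the single condition holds. -/
theorem shock_entropy_single_condition
    (σ N u : ℝ) (hσ0 : 0 < σ) (hσ1 : σ ≤ 1) (hN : 1 < N) (hu0 : 0 < u) (huσ : u < σ)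
    (w : ℝ) (hw : w = ((σ - u) * N - σ * (1 + u)) / ((σ - u) * N + (1 + u))) :
    ((1 / N < ((1 - u) / (1 + u)) * ((σ - u) / (σ + u))) →
      (u < w ∧ w < 1) ∧
      (∀ ρ : ℝ, 0 < ρ →
        (0 < u * ρ ∧ u * ρ < σ * ρ) ∧
        (0 < w * ρ ∧ w * ρ < ρ) ∧
        (0 < u * ρ ∧ u * ρ < w * ρ))) ∧
    (u < w ↔ 1 / N < ((1 - u) / (1 + u)) * ((σ - u) / (σ + u))) := by
  have hsu : 0 < σ - u := sub_pos.mpr huσ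
  have hN0 : 0 < N := by linarith
  have hden : 0 < (σ - u) * N + (1 + u) := by positivity
  have hu1 : 0 < 1 + u := by linarith
  have hσu : 0 < σ + u := by linarith
  have hlt : w < 1 := by
    rw [hw, div_lt_one hden]
    linarith [mul_pos hσ0 hu1]
  have hiff : u < w ↔ 1 / N < ((1 - u) / (1 + u)) * ((σ - u) / (σ + u)) := by
    rw [hw, lt_div_iff₀ hden, div_mul_div_comm, div_lt_div_iff₀ hN0 (mul_pos hu1 hσu)]
    constructor <;> intro h <;> linarith
  refine ⟨fun h => ?_, hiff⟩
  have huw : u < w := hiff.mpr h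
  refine ⟨⟨huw, hlt⟩, fun ρ hρ => ?_⟩
  have huρ : 0 < u * ρ := mul_pos hu0 hρ
  exact ⟨⟨huρ, mul_lt_mul_of_pos_right huσ hρ⟩,
    ⟨mul_pos (hu0.trans huw) hρ, mul_lt_of_lt_one_left hρ hlt⟩,
    ⟨huρ, mul_lt_mul_of_pos_right huw hρ⟩⟩
end
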